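/- arXiv:2309.09999 — 2 statements merged into one kernel-verified Lean document; each statement's English description precedes it below -/
import Mathlib

section
/- Every planar graph is properly 5-colorable. -/
open SimpleGraph

/-- A simple graph is planar if it admits a straight-line drawing in the plane
(by Fáry's theorem this is equivalent to topological planarity for simple graphs):
an injective placement of the vertices such that two distinct edges, drawn as
closed segments, meet only in common endpoints. -/
def IsPlanar {V : Type} (G : SimpleGraph V) : Prop :=
  ∃ pos : V → ℝ × ℝ, Function.Injective pos ∧
    ∀ u v x y : V, G.Adj u v → G.Adj x y → s(u, v) ≠ s(x, y) →
      ∀ p : ℝ × ℝ, p ∈ segment ℝ (pos u) (pos v) → p ∈ segment ℝ (pos x) (pos y) →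
        (p = pos u ∨ p = pos v) ∧ (p = pos x ∨ p = pos y)

/-- A maximal planar graph (planar triangulation): planar, and no edge between
two non-adjacent vertices can be added while preserving planarity. -/
def IsMaximalPlanar {V : Type} [Fintype V] (G : SimpleGraph V) : Prop :=
  IsPlanar G ∧ ∀ u v : V, u ≠ v → ¬ G.Adj u v →
    ¬ IsPlanar (G ⊔ SimpleGraph.fromEdgeSet {s(u, v)})

/-- Vanishing of the van Kampen obstruction mod 2, relative to a tournament `t`. -/
def ZP {V : Type} (t : V → V → ZMod 2) (G : SimpleGraph V) : Prop :=
  ∃ A : V → V → V → ZMod 2, (∀ x y w, A x y w = A y x w) ∧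
    ∀ a b c d, G.Adj a b → G.Adj c d → a ≠ c → a ≠ d → b ≠ c → b ≠ d →
      A a b c + A a b d + A c d a + A c d b = t a c + t a d + t b c + t b d

/-- Contraction of `b` into `a`; `b` becomes isolated. -/
def ctr {V : Type} (G : SimpleGraph V) (a b : V) : SimpleGraph V where
  Adj x y := x ≠ y ∧ x ≠ b ∧ y ≠ b ∧ (G.Adj x y ∨ (x = a ∧ G.Adj b y) ∨ (y = a ∧ G.Adj b x))
  symm := ⟨by
    rintro x y ⟨h1, h2, h3, h4⟩
    refine ⟨h1.symm, h3, h2, ?_⟩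
    rcases h4 with h | h | h
    · exact Or.inl h.symm
    · exact Or.inr (Or.inr h)
    · exact Or.inr (Or.inl h)⟩
  loopless := ⟨fun x h => h.1 rfl⟩

lemma ZP.mono {V : Type} {t : V → V → ZMod 2} {G H : SimpleGraph V} (h : ZP t G) (hl : H ≤ G) :
    ZP t H := by
  obtain ⟨A, h1, h2⟩ := h
  exact ⟨A, h1, fun a b c d hab hcd => h2 a b c d (hl hab) (hl hcd)⟩

lemma zc (x : ZMod 2) : x + x = 0 := CharTwo.add_self_eq_zero x

open Classical in
lemma ZP.ctr {V : Type} {t : V → V → ZMod 2} {G : SimpleGraph V}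
    (ht : ∀ x y, x ≠ y → t x y + t y x = 1) (h : ZP t G) {a b : V}
    (hab : G.Adj a b) : ZP t (ctr G a b) := by
  obtain ⟨A, hs, hA⟩ := h
  let B : V → V → V → ZMod 2 := fun x y w =>
    if G.Adj x y then A x y w else
      if x = a then A b y w + A a b w else if y = a then A b x w + A a b w else 0
  have Bs : ∀ x y w, B x y w = B y x w := by
    intro x y w
    simp only [B, G.adj_comm y x, hs y x]
    by_cases h1 : G.Adj x y
    · simp [h1]
    · by_cases h2 : x = a <;> by_cases h3 : y = a <;> simp [h2, h3]
  have two : (2 : ZMod 2) = 0 := rfl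
  -- edges away from `a`
  have B1 : ∀ x y w, G.Adj x y → B x y w = A x y w := by
    intro x y w h; simp [B, h]
  -- the key step
  have key : ∀ x c d, (_root_.ctr G a b).Adj a x → (_root_.ctr G a b).Adj c d → a ≠ c → a ≠ d →
      x ≠ c → x ≠ d →
      B a x c + B a x d + B c d a + B c d x = t a c + t a d + t x c + t x d := by
    rintro x c d ⟨h1, h2, h3, h4⟩ ⟨k1, k2, k3, k4⟩ hac had hxc hxd
    have kcd : G.Adj c d := by
      rcases k4 with h | h | h
      · exact h
      · exact absurd h.1.symm hac
      · exact absurd h.1.symm had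
    rw [B1 c d _ kcd, B1 c d _ kcd]
    by_cases hax : G.Adj a x
    · rw [B1 a x _ hax, B1 a x _ hax]
      exact hA a x c d hax kcd hac had hxc hxd
    · have hbx : G.Adj b x := by
        rcases h4 with h | h | h
        · exact absurd h hax
        · exact h.2
        · exact absurd h.1.symm h1
      have e1 := hA b x c d hbx kcd k2.symm k3.symm hxc hxd
      have e2 := hA a b c d hab kcd hac had k2.symm k3.symm
      simp only [B, hax, if_false, if_true]
      linear_combination e1 + e2 + (- A c d b + t b c + t b d) * two
  refine ⟨B, Bs, ?_⟩
  intro p q c d hpq hcd hpc hpd hqc hqd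
  have tt : ∀ x y, x ≠ y → t x y = 1 + t y x := by
    intro x y h; linear_combination ht x y h - t y x * two
  by_cases hp : p = a
  · subst hp; exact key q c d hpq hcd hpc hpd hqc hqd
  by_cases hq : q = a
  · subst hq
    have := key p c d hpq.symm hcd hqc hqd hpc hpd
    rw [Bs p q, Bs p q]
    linear_combination this
  by_cases hc : c = a
  · subst hc
    have := key d p q hcd hpq hpc.symm hqc.symm hpd.symm hqd.symm
    rw [tt p c hpc, tt p d hpd, tt q c hqc, tt q d hqd]
    linear_combination this - 2 * two
  by_cases hd : d = a
  · subst hd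
    have := key c p q hcd.symm hpq hpd.symm hqd.symm hpc.symm hqc.symm
    rw [tt p c hpc, tt p d hpd, tt q c hqc, tt q d hqd, Bs c d, Bs c d]
    linear_combination this - 2 * two
  have e1 : G.Adj p q := by
    rcases hpq.2.2.2 with h | h | h
    · exact h
    · exact absurd h.1 hp
    · exact absurd h.1 hq
  have e2 : G.Adj c d := by
    rcases hcd.2.2.2 with h | h | h
    · exact h
    · exact absurd h.1 hc
    · exact absurd h.1 hd
  rw [B1 p q _ e1, B1 p q _ e1, B1 c d _ e2, B1 c d _ e2]
  exact hA p q c d e1 e2 hpc hpd hqc hqd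

lemma ZP.noK5 {V : Type} {t : V → V → ZMod 2} {G : SimpleGraph V}
    (ht : ∀ x y, x ≠ y → t x y + t y x = 1) (h : ZP t G) {a b c d e : V}
    (ab : G.Adj a b) (ac : G.Adj a c) (ad : G.Adj a d) (ae : G.Adj a e)
    (bc : G.Adj b c) (bd : G.Adj b d) (be : G.Adj b e)
    (cd : G.Adj c d) (ce : G.Adj c e) (de : G.Adj d e) : False := by
  obtain ⟨A, hs, hA⟩ := h
  have two : (2 : ZMod 2) = 0 := rfl
  have tt : ∀ x y, G.Adj x y → t y x = 1 + t x y := by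
    intro x y h; linear_combination ht x y h.ne - t x y * two
  have q : ∀ w x y z, G.Adj w x → G.Adj w y → G.Adj w z → G.Adj x y → G.Adj x z → G.Adj y z →
    (A w x y + A w x z + A y z w + A y z x) + (A w y x + A w y z + A x z w + A x z y)
     + (A w z x + A w z y + A x y w + A x y z) = 1 := by
    intro w x y z wx wy wz xy xz yz
    have e1 := hA w x y z wx yz wy.ne wz.ne xy.ne xz.ne
    have e2 := hA w y x z wy xz wx.ne wz.ne xy.ne.symm yz.ne
    have e3 := hA w z x y wz xy wx.ne wy.ne xz.ne.symm yz.ne.symm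
    rw [tt x y xy] at e2
    rw [tt x z xz, tt y z yz] at e3
    linear_combination e1 + e2 + e3 + (t w x + t w y + t w z + t x y + t x z + t y z + 1) * two
  have r1 := q a b c d ab ac ad bc bd cd
  have r2 := q a b c e ab ac ae bc be ce
  have r3 := q a b d e ab ad ae bd be de
  have r4 := q a c d e ac ad ae cd ce de
  have r5 := q b c d e bc bd be cd ce de
  have : (1 : ZMod 2) = 0 := by
    linear_combination -(r1 + r2 + r3 + r4 + r5) + (-2 +
      A a b c + A a b d + A a b e + A a c b + A a c d + A a c e + A a d b + A a d c + A a d e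
      + A a e b + A a e c + A a e d + A b c a + A b c d + A b c e + A b d a + A b d c + A b d e
      + A b e a + A b e c + A b e d + A c d a + A c d b + A c d e + A c e a + A c e b + A c e d
      + A d e a + A d e b + A d e c) * two
  exact one_ne_zero this

open Classical in
lemma ctr_edges {V : Type} [Fintype V] (G : SimpleGraph V) {a b : V} (hab : G.Adj a b) :
    G.edgeFinset.card ≤ (ctr G a b).edgeFinset.card + 1 +
      (G.neighborFinset a ∩ G.neighborFinset b).card := by
  set T := (G.neighborFinset b \ G.neighborFinset a).erase a with hT
  have h1 : (G.edgeFinset.filter (fun e => b ∉ e)) ∪ T.image (fun x => s(a, x)) ⊆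
      (ctr G a b).edgeFinset := by
    intro e
    induction e using Sym2.ind with
    | _ x y =>
      intro he
      rw [mem_edgeFinset, mem_edgeSet]
      rw [Finset.mem_union] at he
      rcases he with he | he
      · simp only [Finset.mem_filter, mem_edgeFinset, mem_edgeSet, Sym2.mem_iff, not_or] at he
        exact ⟨he.1.ne, Ne.symm he.2.1, Ne.symm he.2.2, Or.inl he.1⟩
      · rw [Finset.mem_image] at he
        obtain ⟨z, hz, hz2⟩ := he
        rw [← mem_edgeSet, ← hz2, mem_edgeSet]
        simp only [hT, Finset.mem_erase, Finset.mem_sdiff, mem_neighborFinset] at hz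
        exact ⟨hz.1.symm, hab.ne, hz.2.1.ne.symm, Or.inr (Or.inl ⟨rfl, hz.2.1⟩)⟩
  have h2 : Disjoint (G.edgeFinset.filter (fun e => b ∉ e)) (T.image (fun x => s(a, x))) := by
    rw [Finset.disjoint_left]
    intro e he he2
    rw [Finset.mem_image] at he2
    obtain ⟨z, hz, rfl⟩ := he2
    simp only [Finset.mem_filter, mem_edgeFinset, mem_edgeSet] at he
    simp only [hT, Finset.mem_erase, Finset.mem_sdiff, mem_neighborFinset] at hz
    exact hz.2.2 he.1
  have h3 : (T.image (fun x => s(a, x))).card = T.card := by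
    apply Finset.card_image_of_injective
    intro x y hxy
    exact Sym2.congr_right.1 hxy
  have h4 := Finset.card_le_card h1
  rw [Finset.card_union_of_disjoint h2, h3] at h4
  have h5 : (G.edgeFinset.filter (fun e => b ∈ e)).card = G.degree b := by
    rw [← G.card_incidenceFinset_eq_degree b, G.incidenceFinset_eq_filter]
  have h6 := Finset.card_filter_add_card_filter_not (s := G.edgeFinset) (fun e => b ∈ e)
  have h7 : T.card + 1 = (G.neighborFinset b \ G.neighborFinset a).card := by
    apply Finset.card_erase_add_one
    simp [hab.symm]
  have h8 := Finset.card_sdiff_add_card_inter (G.neighborFinset b) (G.neighborFinset a)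
  rw [Finset.inter_comm] at h8
  rw [card_neighborFinset_eq_degree] at h8
  omega

open Classical in
lemma exists_low {V : Type} [Fintype V] (G : SimpleGraph V) (S : Finset V)
    (hS : ∀ x y, G.Adj x y → x ∈ S) (k : ℕ) (h : 2 * G.edgeFinset.card < k * S.card) :
    ∃ v ∈ S, G.degree v < k := by
  by_contra hc
  push Not at hc
  have h1 : S.card * k ≤ ∑ v ∈ S, G.degree v := by
    rw [← smul_eq_mul]
    exact Finset.card_nsmul_le_sum _ _ _ hc
  have h2 : ∑ v ∈ S, G.degree v ≤ ∑ v, G.degree v :=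
    Finset.sum_le_sum_of_subset (Finset.subset_univ _)
  rw [G.sum_degrees_eq_twice_card_edges] at h2
  rw [mul_comm] at h1
  omega

open Classical in
lemma deg_lt {V : Type} [Fintype V] (G : SimpleGraph V) (S : Finset V)
    (hS : ∀ x y, G.Adj x y → x ∈ S) (v : V) (hv : v ∈ S) : G.degree v + 1 ≤ S.card := by
  rw [← card_neighborFinset_eq_degree, ← Finset.card_erase_add_one hv]
  have : G.neighborFinset v ⊆ S.erase v := by
    intro x hx
    rw [mem_neighborFinset] at hx
    exact Finset.mem_erase.2 ⟨hx.ne.symm, hS x v hx.symm⟩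
  have := Finset.card_le_card this
  omega

open Classical in
lemma edges_small {V : Type} [Fintype V] (G : SimpleGraph V) (S : Finset V)
    (hS : ∀ x y, G.Adj x y → x ∈ S) : 2 * G.edgeFinset.card ≤ S.card * (S.card - 1) := by
  rw [← G.sum_degrees_eq_twice_card_edges]
  have : ∑ v, G.degree v = ∑ v ∈ S, G.degree v := by
    symm
    apply Finset.sum_subset (Finset.subset_univ _)
    intro x _ hx
    rw [← card_neighborFinset_eq_degree, Finset.card_eq_zero, Finset.eq_empty_iff_forall_notMem]
    intro y hy
    rw [mem_neighborFinset] at hy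
    exact hx (hS _ _ hy)
  rw [this, ← smul_eq_mul]
  apply Finset.sum_le_card_nsmul
  intro x hx
  have := deg_lt G S hS x hx
  omega

lemma ctr_supp {V : Type} [DecidableEq V] {G : SimpleGraph V} {S : Finset V} {a b : V}
    (hS : ∀ x y, G.Adj x y → x ∈ S) (hab : G.Adj a b) :
    ∀ x y, (ctr G a b).Adj x y → x ∈ S.erase b := by
  rintro x y ⟨h1, h2, h3, h4⟩
  refine Finset.mem_erase.2 ⟨h2, ?_⟩
  rcases h4 with h | h | h
  · exact hS _ _ h
  · rw [h.1]; exact hS _ _ hab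
  · exact hS _ _ h.2.symm

open Classical in
lemma edge_bound {V : Type} [Fintype V] {t : V → V → ZMod 2}
    (ht : ∀ x y, x ≠ y → t x y + t y x = 1) (n : ℕ) (hn : 3 ≤ n) :
    ∀ (S : Finset V) (G : SimpleGraph V), S.card = n → (∀ x y, G.Adj x y → x ∈ S) →
      ZP t G → G.edgeFinset.card + 6 ≤ 3 * n := by
  induction n, hn using Nat.le_induction with
  | base =>
    intro S G hc hS _
    have := edges_small G S hS
    rw [hc] at this
    omega
  | succ n hn ih =>
    intro S G0 hc hS0 hZ0
    by_contra hcon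
    obtain ⟨E, hE, hEc⟩ := Finset.exists_subset_card_eq (s := G0.edgeFinset) (n := 3 * n - 2)
      (by omega)
    obtain ⟨G, hle, hm⟩ : ∃ G : SimpleGraph V, G ≤ G0 ∧ G.edgeFinset.card = 3 * n - 2 := by
      have hle : fromEdgeSet (E : Set (Sym2 V)) ≤ G0 := by
        intro x y hxy
        rw [fromEdgeSet_adj] at hxy
        have := hE (Finset.mem_coe.1 hxy.1)
        rwa [mem_edgeFinset, mem_edgeSet] at this
      set G := fromEdgeSet (E : Set (Sym2 V)) with hGdef
      have hGE : G.edgeFinset = E := by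
        ext e
        rw [mem_edgeFinset, hGdef, edgeSet_fromEdgeSet]
        simp only [Set.mem_sdiff, Finset.mem_coe]
        constructor
        · exact fun h => h.1
        · intro h
          refine ⟨h, ?_⟩
          have := hE h
          rw [mem_edgeFinset] at this
          exact G0.not_isDiag_of_mem_edgeSet this
      exact ⟨G, hle, by rw [← hEc, ← hGE]; congr!⟩
    have hS : ∀ x y, G.Adj x y → x ∈ S := fun x y h => hS0 x y (hle h)
    have hZ := hZ0.mono hle
    have tri : ∀ a b, G.Adj a b → 3 ≤ (G.neighborFinset a ∩ G.neighborFinset b).card := by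
      intro a b hab
      have h1 := ctr_edges G hab
      have h2 := ih (S.erase b) (ctr G a b)
        (by rw [Finset.card_erase_of_mem (hS b a hab.symm), hc]; rfl)
        (ctr_supp hS hab) (hZ.ctr ht hab)
      omega
    obtain ⟨v, hv, hd⟩ := exists_low G S hS 6 (by rw [hm, hc]; omega)
    have hne : ∃ u, G.Adj v u := by
      by_contra hno
      push Not at hno
      have := ih (S.erase v) G (by rw [Finset.card_erase_of_mem hv, hc]; rfl) (by
        intro x y h
        refine Finset.mem_erase.2 ⟨?_, hS x y h⟩
        rintro rfl
        exact hno _ h) hZ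
      omega
    set N := G.neighborFinset v with hN
    rw [← card_neighborFinset_eq_degree, ← hN] at hd
    have hNa : ∀ x, x ∈ N ↔ G.Adj v x := fun x => by rw [hN, mem_neighborFinset]
    have tri2 : ∀ u ∈ N, 3 ≤ (N.filter (fun x => G.Adj u x)).card := by
      intro u hu
      refine (tri v u ((hNa u).1 hu)).trans (Finset.card_le_card ?_)
      intro x hx
      simp only [Finset.mem_inter, mem_neighborFinset] at hx
      exact Finset.mem_filter.2 ⟨(hNa x).2 hx.1, hx.2⟩
    have tri3 : ∀ u ∈ N, (N.filter (fun x => ¬ G.Adj u x)).card ≤ 2 := by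
      intro u hu
      have := tri2 u hu
      have := Finset.card_filter_add_card_filter_not (s := N) (fun x => G.Adj u x)
      omega
    have non : ∀ a ∈ N, ∀ b ∈ N, a ≠ b → ¬ G.Adj a b → ∀ x ∈ N, x ≠ a → x ≠ b → G.Adj a x := by
      intro a ha b hb hab hn x hx hxa hxb
      by_contra hh
      have h3 : ({a, b, x} : Finset V) ⊆ N.filter (fun x => ¬ G.Adj a x) := by
        intro y hy
        simp only [Finset.mem_insert, Finset.mem_singleton] at hy
        rcases hy with rfl | rfl | rfl
        · exact Finset.mem_filter.2 ⟨ha, G.irrefl⟩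
        · exact Finset.mem_filter.2 ⟨hb, hn⟩
        · exact Finset.mem_filter.2 ⟨hx, hh⟩
      have := Finset.card_le_card h3
      rw [Finset.card_eq_three.2 ⟨a, b, x, hab, hxa.symm, hxb.symm, rfl⟩] at this
      have := tri3 a ha
      omega
    have hN4 : 4 ≤ N.card := by
      obtain ⟨u, hu⟩ := hne
      have h1 := tri2 u ((hNa u).2 hu)
      have h2 : N.filter (fun x => G.Adj u x) ⊆ N.erase u := by
        intro x hx
        rw [Finset.mem_filter] at hx
        exact Finset.mem_erase.2 ⟨hx.2.ne.symm, hx.1⟩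
      have h3 := Finset.card_le_card h2
      rw [Finset.card_erase_of_mem ((hNa u).2 hu)] at h3
      omega
    by_cases hcl : ∀ a ∈ N, ∀ b ∈ N, a ≠ b → G.Adj a b
    · obtain ⟨M, hM, hM4⟩ := Finset.exists_subset_card_eq hN4
      obtain ⟨a, b, c, d, ab, ac, ad, bc, bd, cd, rfl⟩ := Finset.card_eq_four.1 hM4
      have ha : a ∈ N := hM (by simp)
      have hb : b ∈ N := hM (by simp)
      have hc : c ∈ N := hM (by simp)
      have hd : d ∈ N := hM (by simp)
      exact hZ.noK5 ht ((hNa _).1 ha) ((hNa _).1 hb) ((hNa _).1 hc) ((hNa _).1 hd)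
        (hcl _ ha _ hb ab) (hcl _ ha _ hc ac) (hcl _ ha _ hd ad)
        (hcl _ hb _ hc bc) (hcl _ hb _ hd bd) (hcl _ hc _ hd cd)
    · push Not at hcl
      obtain ⟨a, ha, b, hb, hab, hnab⟩ := hcl
      have hnba : ¬ G.Adj b a := fun h => hnab h.symm
      -- the final configuration
      have fin : ∀ c ∈ N, ∀ d ∈ N, ∀ e ∈ N, c ≠ a → c ≠ b → d ≠ a → d ≠ b → e ≠ a → e ≠ b →
          c ≠ d → c ≠ e → G.Adj d e → False := by
        intro c hc d hd e he ca cb da db ea eb cd ce hde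
        have aX := non a ha b hb hab hnab
        have bX := non b hb a ha hab.symm hnba
        have hac := aX c hc ca cb
        have hv : ∀ x ∈ N, v ≠ x := fun x hx => ((hNa x).1 hx).ne
        refine (hZ.ctr ht hac).noK5 ht (a := v) (b := a) (c := b) (d := d) (e := e)
          ⟨hv _ ha, hv _ hc, ca.symm, Or.inl ((hNa _).1 ha)⟩
          ⟨hv _ hb, hv _ hc, cb.symm, Or.inl ((hNa _).1 hb)⟩
          ⟨hv _ hd, hv _ hc, cd.symm, Or.inl ((hNa _).1 hd)⟩
          ⟨hv _ he, hv _ hc, ce.symm, Or.inl ((hNa _).1 he)⟩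
          ⟨hab, ca.symm, cb.symm, Or.inr (Or.inl ⟨rfl, (bX c hc cb ca).symm⟩)⟩
          ⟨da.symm, ca.symm, cd.symm, Or.inl (aX d hd da db)⟩
          ⟨ea.symm, ca.symm, ce.symm, Or.inl (aX e he ea eb)⟩
          ⟨db.symm, cb.symm, cd.symm, Or.inl (bX d hd db da)⟩
          ⟨eb.symm, cb.symm, ce.symm, Or.inl (bX e he eb ea)⟩
          ⟨hde.ne, cd.symm, ce.symm, Or.inl hde⟩
      have hM : 3 ≤ ((N.erase a).erase b).card := by
        refine (tri2 a ha).trans (Finset.card_le_card ?_)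
        intro x hx
        rw [Finset.mem_filter] at hx
        refine Finset.mem_erase.2 ⟨?_, Finset.mem_erase.2 ⟨hx.2.ne.symm, hx.1⟩⟩
        rintro rfl
        exact hnab hx.2
      obtain ⟨M, hM, hM3⟩ := Finset.exists_subset_card_eq hM
      obtain ⟨c, d, e, cd, ce, de, rfl⟩ := Finset.card_eq_three.1 hM3
      have hc := hM (show c ∈ _ by simp)
      have hd := hM (show d ∈ _ by simp)
      have he := hM (show e ∈ _ by simp)
      simp only [Finset.mem_erase] at hc hd he
      by_cases hde : G.Adj d e
      · exact fin c hc.2.2 d hd.2.2 e he.2.2 hc.2.1 hc.1 hd.2.1 hd.1 he.2.1 he.1 cd ce hde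
      · have := non d hd.2.2 e he.2.2 de hde c hc.2.2 cd ce
        exact fin e he.2.2 d hd.2.2 c hc.2.2 he.2.1 he.1 hd.2.1 hd.1 hc.2.1 hc.1 de.symm ce.symm this

open Classical in
/-- Extend a colouring of `G - v` over `v`, when the neighbours use at most four colours. -/
lemma extend_color {V : Type} [Fintype V] (G : SimpleGraph V) (v : V) (f : V → Fin 5)
    (hf : ∀ x y, x ≠ v → y ≠ v → G.Adj x y → f x ≠ f y)
    (hc : ((G.neighborFinset v).image f).card ≤ 4) : G.Colorable 5 := by
  obtain ⟨c, hc⟩ : ∃ c, c ∉ (G.neighborFinset v).image f := by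
    by_contra h
    push Not at h
    rw [Finset.eq_univ_iff_forall.2 h] at hc
    simp at hc
  have hc' : ∀ x, G.Adj v x → f x ≠ c := by
    intro x hx h
    exact hc (Finset.mem_image.2 ⟨x, by simpa using hx, h⟩)
  refine ⟨Coloring.mk (Function.update f v c) ?_⟩
  intro x y hxy
  by_cases hx : x = v
  · subst hx
    rw [Function.update_self, Function.update_of_ne hxy.ne.symm]
    exact (hc' y hxy).symm
  · by_cases hy : y = v
    · subst hy
      rw [Function.update_self, Function.update_of_ne hx]
      exact hc' x hxy.symm
    · rw [Function.update_of_ne hx, Function.update_of_ne hy]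
      exact hf x y hx hy hxy

open Classical in
lemma color_of_ZP {V : Type} [Fintype V] {t : V → V → ZMod 2}
    (ht : ∀ x y, x ≠ y → t x y + t y x = 1) (n : ℕ) :
    ∀ (S : Finset V) (G : SimpleGraph V), S.card = n → (∀ x y, G.Adj x y → x ∈ S) →
      ZP t G → G.Colorable 5 := by
  induction n using Nat.strong_induction_on with
  | _ n ih =>
  intro S G hc hS hZ
  rcases Finset.eq_empty_or_nonempty S with rfl | hne
  · exact ⟨Coloring.mk (fun _ => 0) (fun h => absurd (hS _ _ h) (by simp))⟩
  obtain ⟨v, hv, hd⟩ : ∃ v ∈ S, G.degree v < 6 := by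
    by_cases h3 : 3 ≤ n
    · have := edge_bound ht n h3 S G hc hS hZ
      exact exists_low G S hS 6 (by omega)
    · obtain ⟨v, hv⟩ := hne
      have := deg_lt G S hS v hv
      exact ⟨v, hv, by omega⟩
  have hpos : 0 < n := by rw [← hc]; exact hne.card_pos
  have hNa : ∀ x, x ∈ G.neighborFinset v ↔ G.Adj v x := fun x => by rw [mem_neighborFinset]
  by_cases h5 : G.degree v ≤ 4
  · let H : SimpleGraph V := G.deleteIncidenceSet v
    have hH : ∀ x y, H.Adj x y ↔ G.Adj x y ∧ x ≠ v ∧ y ≠ v := fun x y => G.deleteIncidenceSet_adj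
    obtain ⟨f⟩ := ih (n - 1) (by omega) (S.erase v) H
      (by rw [Finset.card_erase_of_mem hv, hc])
      (fun x y h => Finset.mem_erase.2 ⟨((hH x y).1 h).2.1, hS x y ((hH x y).1 h).1⟩)
      (hZ.mono (fun x y h => ((hH x y).1 h).1))
    refine extend_color G v f (fun x y hx hy h => f.valid ((hH x y).2 ⟨h, hx, hy⟩)) ?_
    refine Finset.card_image_le.trans ?_
    rwa [card_neighborFinset_eq_degree]
  · have h5 : (G.neighborFinset v).card = 5 := by rw [card_neighborFinset_eq_degree]; omega
    obtain ⟨x, hx, y, hy, hxy, hn⟩ : ∃ x, G.Adj v x ∧ ∃ y, G.Adj v y ∧ x ≠ y ∧ ¬ G.Adj x y := by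
      by_contra hcl
      push Not at hcl
      obtain ⟨M, hM, hM4⟩ := Finset.exists_subset_card_eq (s := G.neighborFinset v) (n := 4)
        (by omega)
      obtain ⟨a, b, c, d, ab, ac, ad, bc, bd, cd, rfl⟩ := Finset.card_eq_four.1 hM4
      have ha := (hNa a).1 (hM (by simp))
      have hb := (hNa b).1 (hM (by simp))
      have hc := (hNa c).1 (hM (by simp))
      have hd := (hNa d).1 (hM (by simp))
      exact hZ.noK5 ht ha hb hc hd
        (hcl _ ha _ hb ab) (hcl _ ha _ hc ac) (hcl _ ha _ hd ad)
        (hcl _ hb _ hc bc) (hcl _ hb _ hd bd) (hcl _ hc _ hd cd)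
    have hy1 : (ctr G v x).Adj v y := ⟨hy.ne, hx.ne, hxy.symm, Or.inl hy⟩
    have hxS := hS x v hx.symm
    obtain ⟨f⟩ := ih ((S.erase x).erase y).card (by
        refine lt_of_le_of_lt (Finset.card_le_card (Finset.erase_subset _ _)) ?_
        rw [Finset.card_erase_of_mem hxS, hc]; omega) _ (ctr (ctr G v x) v y) rfl
      (ctr_supp (ctr_supp hS hx) hy1) ((hZ.ctr ht hx).ctr ht hy1)
    let g : V → Fin 5 := fun z => if z = x ∨ z = y then f v else f z
    have gx : g x = f v := by simp [g]
    have gy : g y = f v := by simp [g]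
    have go : ∀ z, z ≠ x → z ≠ y → g z = f z := by
      intro z h1 h2; simp [g, h1, h2]
    have fx : ∀ z, z ≠ v → G.Adj x z → f v ≠ g z := by
      intro z hzv h
      have hzy : z ≠ y := by rintro rfl; exact hn h
      rw [go z h.ne.symm hzy]
      exact f.valid ⟨hzv.symm, hy.ne, hzy, Or.inl ⟨hzv.symm, hx.ne, h.ne.symm,
        Or.inr (Or.inl ⟨rfl, h⟩)⟩⟩
    have fy : ∀ z, z ≠ v → G.Adj y z → f v ≠ g z := by
      intro z hzv h
      have hzx : z ≠ x := by rintro rfl; exact hn h.symm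
      rw [go z hzx h.ne.symm]
      exact f.valid ⟨hzv.symm, hy.ne, h.ne.symm, Or.inr (Or.inl ⟨rfl, h.ne, hxy.symm, hzx,
        Or.inl h⟩)⟩
    refine extend_color G v g ?_ ?_
    · intro p q hp hq hpq
      by_cases h1 : p = x
      · subst h1; rw [gx]; exact fx q hq hpq
      by_cases h2 : p = y
      · subst h2; rw [gy]; exact fy q hq hpq
      by_cases h3 : q = x
      · subst h3; rw [gx]; exact (fx p hp hpq.symm).symm
      by_cases h4 : q = y
      · subst h4; rw [gy]; exact (fy p hp hpq.symm).symm
      rw [go p h1 h2, go q h3 h4]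
      exact f.valid ⟨hpq.ne, h2, h4, Or.inl ⟨hpq.ne, h1, h3, Or.inl hpq⟩⟩
    · have : (G.neighborFinset v).image g ⊆ ((G.neighborFinset v).erase x).image g := by
        intro c hc
        rw [Finset.mem_image] at hc
        obtain ⟨z, hz, rfl⟩ := hc
        by_cases h : z = x
        · subst h
          refine Finset.mem_image.2 ⟨y, Finset.mem_erase.2 ⟨hxy.symm, (hNa y).2 hy⟩, ?_⟩
          rw [gx, gy]
        · exact Finset.mem_image.2 ⟨z, Finset.mem_erase.2 ⟨h, hz⟩, rfl⟩
      refine (Finset.card_le_card this).trans (Finset.card_image_le.trans ?_)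
      rw [Finset.card_erase_of_mem ((hNa x).2 hx), h5]

/-! ### Geometry -/

/-- Height at abscissa `s` of the line through `(x1,y1)`, `(x2,y2)`. -/
noncomputable def lin (x1 y1 x2 y2 s : ℝ) : ℝ := y1 + (s - x1) / (x2 - x1) * (y2 - y1)

lemma exists_generic {V : Type} [Fintype V] (pos : V → ℝ × ℝ) (hp : Function.Injective pos) :
    ∃ s : ℝ, Function.Injective (fun v => (pos v).1 + s * (pos v).2) := by
  classical
  let F : Set ℝ := ⋃ q : V × V, {((pos q.2).1 - (pos q.1).1) / ((pos q.1).2 - (pos q.2).2)}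
  have hF : F.Finite := Set.finite_iUnion (fun _ => Set.finite_singleton _)
  obtain ⟨s, hs⟩ := hF.exists_notMem
  refine ⟨s, fun u v huv => ?_⟩
  simp only at huv
  by_contra hne
  by_cases h2 : (pos u).2 = (pos v).2
  · apply hne
    apply hp
    refine Prod.ext ?_ h2
    rw [h2] at huv
    linarith
  · apply hs
    refine Set.mem_iUnion.2 ⟨(u, v), ?_⟩
    rw [Set.mem_singleton_iff, eq_div_iff (sub_ne_zero.2 h2)]
    linarith

/-- If the two lines swap order over a common interval, the segments meet. -/
lemma seg_meet (s : ℝ) (a b c d : ℝ × ℝ) (h : ℝ × ℝ → ℝ) (hh : ∀ p, h p = p.1 + s * p.2)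
    (hab : h a < h b) (hcd : h c < h d) (l r : ℝ) (hlr : l ≤ r) (hal : h a ≤ l) (hcl : h c ≤ l)
    (hrb : r ≤ h b) (hrd : r ≤ h d)
    (hD : (lin (h a) a.2 (h b) b.2 l - lin (h c) c.2 (h d) d.2 l) *
      (lin (h a) a.2 (h b) b.2 r - lin (h c) c.2 (h d) d.2 r) ≤ 0) :
    ∃ p, p ∈ segment ℝ a b ∧ p ∈ segment ℝ c d := by
  have cont : Continuous (fun z => lin (h a) a.2 (h b) b.2 z - lin (h c) c.2 (h d) d.2 z) := by
    unfold lin; fun_prop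
  obtain ⟨z, hz, hz0⟩ : ∃ z ∈ Set.Icc l r,
      lin (h a) a.2 (h b) b.2 z - lin (h c) c.2 (h d) d.2 z = 0 := by
    rcases mul_nonpos_iff.1 hD with hD | hD
    · exact intermediate_value_Icc' hlr cont.continuousOn ⟨hD.2, hD.1⟩
    · exact intermediate_value_Icc hlr cont.continuousOn ⟨hD.1, hD.2⟩
  have mem : ∀ a b : ℝ × ℝ, h a < h b → h a ≤ z → z ≤ h b →
      (z - s * lin (h a) a.2 (h b) b.2 z, lin (h a) a.2 (h b) b.2 z) ∈ segment ℝ a b := by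
    intro a b hab h1 h2
    rw [segment_eq_image']
    have hpos : 0 < h b - h a := sub_pos.2 hab
    refine ⟨(z - h a) / (h b - h a), ⟨div_nonneg (by linarith) hpos.le,
      (div_le_one hpos).2 (by linarith)⟩, ?_⟩
    have key : (z - h a) / (h b - h a) * (h b - h a) = z - h a := div_mul_cancel₀ _ hpos.ne'
    set τ := (z - h a) / (h b - h a) with hτ
    refine Prod.ext ?_ ?_
    · simp only [lin, ← hτ, Prod.fst_add, Prod.smul_fst, Prod.fst_sub, smul_eq_mul]
      rw [hh a, hh b] at key
      linarith
    · simp only [lin, ← hτ, Prod.snd_add, Prod.smul_snd, Prod.snd_sub, smul_eq_mul]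
  refine ⟨_, mem a b hab (hal.trans hz.1) (hz.2.trans hrb), ?_⟩
  rw [sub_eq_zero.1 hz0]
  exact mem c d hcd (hcl.trans hz.1) (hz.2.trans hrd)

lemma lin_left (x1 y1 x2 y2 : ℝ) : lin x1 y1 x2 y2 x1 = y1 := by simp [lin]

lemma lin_right (x1 y1 x2 y2 : ℝ) (h : x1 < x2) : lin x1 y1 x2 y2 x2 = y2 := by
  have : x2 - x1 ≠ 0 := (sub_pos.2 h).ne'
  simp [lin, div_self this]

open Classical in
lemma ZP_of_planar {V : Type} [Fintype V] (G : SimpleGraph V) (hG : IsPlanar G) :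
    ∃ t : V → V → ZMod 2, (∀ x y, x ≠ y → t x y + t y x = 1) ∧ ZP t G := by
  obtain ⟨pos, hinj, hpl⟩ := hG
  obtain ⟨s, hs⟩ := exists_generic pos hinj
  let h : ℝ × ℝ → ℝ := fun p => p.1 + s * p.2
  have hs' : ∀ x y, x ≠ y → h (pos x) ≠ h (pos y) := fun x y hxy e => hxy (hs e)
  let t : V → V → ZMod 2 := fun x y => if h (pos x) < h (pos y) then 1 else 0
  let A0 : V → V → V → ZMod 2 := fun x y w =>
    if h (pos x) < h (pos w) ∧ h (pos w) < h (pos y) ∧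
      lin (h (pos x)) (pos x).2 (h (pos y)) (pos y).2 (h (pos w)) < (pos w).2 then 1 else 0
  let A : V → V → V → ZMod 2 := fun x y w =>
    if h (pos x) < h (pos y) then A0 x y w else A0 y x w
  have two : (2 : ZMod 2) = 0 := rfl
  have ht : ∀ x y, x ≠ y → t x y + t y x = 1 := by
    intro x y hxy
    rcases lt_or_gt_of_ne (hs' x y hxy) with hl | hl <;> simp [t, hl, hl.le, not_lt.2 hl.le]
  have tt : ∀ x y, x ≠ y → t x y = 1 + t y x := by
    intro x y h; linear_combination ht x y h - t y x * two
  have hAs : ∀ x y w, A x y w = A y x w := by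
    intro x y w
    by_cases hxy : x = y
    · rw [hxy]
    rcases lt_or_gt_of_ne (hs' x y hxy) with hl | hl <;> simp [A, hl, not_lt.2 hl.le]
  refine ⟨t, ht, A, hAs, ?_⟩
  -- main case
  have main : ∀ a b c d, G.Adj a b → G.Adj c d → a ≠ c → a ≠ d → b ≠ c → b ≠ d →
      h (pos a) < h (pos b) → h (pos c) < h (pos d) → h (pos a) < h (pos c) →
      A a b c + A a b d + A c d a + A c d b = t a c + t a d + t b c + t b d := by
    intro a b c d hab hcd nac nad nbc nbd lab lcd lac
    have nomeet : ¬ ∃ p, p ∈ segment ℝ (pos a) (pos b) ∧ p ∈ segment ℝ (pos c) (pos d) := by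
      rintro ⟨p, p1, p2⟩
      have hne : s(a, b) ≠ s(c, d) := by
        intro e
        rw [Sym2.eq_iff] at e
        rcases e with e | e
        · exact nac e.1
        · exact nad e.1
      obtain ⟨q1, q2⟩ := hpl a b c d hab hcd hne p p1 p2
      rcases q1 with q1 | q1 <;> rcases q2 with q2 | q2 <;> have := hinj (q1.symm.trans q2)
      · exact nac this
      · exact nad this
      · exact nbc this
      · exact nbd this
    have lad := lac.trans lcd
    have mt := seg_meet s (pos a) (pos b) (pos c) (pos d) h (fun _ => rfl) lab lcd
    rcases lt_or_gt_of_ne (hs' b c nbc) with lbc | lcb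
    · have lbd := lbc.trans lcd
      simp only [A, A0, t, lab, lcd, lac, lad, lbc, lbd, not_lt.2 lbc.le, not_lt.2 lbd.le,
        not_lt.2 lac.le, if_true, if_false, true_and, false_and, and_false]
      decide
    rcases lt_or_gt_of_ne (hs' b d nbd) with lbd | ldb
    · have hD := mt (h (pos c)) (h (pos b)) lcb.le lac.le le_rfl le_rfl lbd.le
      rw [lin_left, lin_right _ _ _ _ lab] at hD
      have hD' := not_le.1 (fun hh => nomeet (hD hh))
      simp only [A, A0, t, lab, lcd, lac, lad, lcb, lbd, not_lt.2 lcb.le, not_lt.2 lbd.le,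
        not_lt.2 lac.le, if_true, if_false, true_and, false_and, and_false]
      rcases mul_pos_iff.1 hD' with ⟨e1, e2⟩ | ⟨e1, e2⟩
      · rw [if_neg (not_lt.2 (sub_pos.1 e1).le), if_pos (sub_pos.1 e2)]; decide
      · rw [if_pos (sub_neg.1 e1), if_neg (not_lt.2 (sub_neg.1 e2).le)]; decide
    · have hD := mt (h (pos c)) (h (pos d)) lcd.le lac.le le_rfl ldb.le le_rfl
      rw [lin_left, lin_right (h (pos c)) _ _ _ lcd] at hD
      have hD' := not_le.1 (fun hh => nomeet (hD hh))
      simp only [A, A0, t, lab, lcd, lac, lad, lcb, ldb, not_lt.2 lcb.le, not_lt.2 ldb.le,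
        not_lt.2 lac.le, if_true, if_false, true_and, false_and, and_false]
      rcases mul_pos_iff.1 hD' with ⟨e1, e2⟩ | ⟨e1, e2⟩
      · rw [if_neg (not_lt.2 (sub_pos.1 e1).le), if_neg (not_lt.2 (sub_pos.1 e2).le)]; decide
      · rw [if_pos (sub_neg.1 e1), if_pos (sub_neg.1 e2)]
  have main2 : ∀ a b c d, G.Adj a b → G.Adj c d → a ≠ c → a ≠ d → b ≠ c → b ≠ d →
      h (pos a) < h (pos b) → h (pos c) < h (pos d) →
      A a b c + A a b d + A c d a + A c d b = t a c + t a d + t b c + t b d := by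
    intro a b c d hab hcd nac nad nbc nbd lab lcd
    rcases lt_or_gt_of_ne (hs' a c nac) with l | l
    · exact main a b c d hab hcd nac nad nbc nbd lab lcd l
    · have := main c d a b hcd hab nac.symm nbc.symm nad.symm nbd.symm lcd lab l
      rw [tt a c nac, tt a d nad, tt b c nbc, tt b d nbd]
      linear_combination this - 2 * two
  intro a b c d hab hcd nac nad nbc nbd
  rcases lt_or_gt_of_ne (hs' a b hab.ne) with l1 | l1 <;>
    rcases lt_or_gt_of_ne (hs' c d hcd.ne) with l2 | l2
  · exact main2 a b c d hab hcd nac nad nbc nbd l1 l2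
  · have := main2 a b d c hab hcd.symm nad nac nbd nbc l1 l2
    rw [hAs c d, hAs c d]; linear_combination this
  · have := main2 b a c d hab.symm hcd nbc nbd nac nad l1 l2
    rw [hAs a b, hAs a b]; linear_combination this
  · have := main2 b a d c hab.symm hcd.symm nbd nbc nad nac l1 l2
    rw [hAs a b, hAs a b, hAs c d, hAs c d]; linear_combination this

/-- The Five Color Theorem: every finite planar graph is properly 5-colorable. -/
theorem stmt_8 {V : Type} [Fintype V] (G : SimpleGraph V) (hG : IsPlanar G) :
    G.Colorable 5 := by
  obtain ⟨t, ht, hZ⟩ := ZP_of_planar G hG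
  exact color_of_ZP ht _ Finset.univ G rfl (fun x _ _ => Finset.mem_univ x) hZ
end

section
/- Let G be a plane triangulation properly edge-3-colored so that every triangular face has its three edges colored with three distinct colors (an RGB-tiling), and let C be a cycle in G. Then the number of red edges, the number of green edges, and the number of blue edges on C all have the same parity as the length of |C| modulo 2; in particular if |C| is even all three counts are even, and if |C| is odd all three are odd. -/
open SimpleGraph

def Meet17 {V : Type} (X Y : V → ℝ) (u v x y : V) (s t : ℝ) : Prop :=
  0 ≤ s ∧ s ≤ 1 ∧ 0 ≤ t ∧ t ≤ 1 ∧ X u + s * (X v - X u) = X x + t * (X y - X x) ∧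
    Y u + s * (Y v - Y u) = Y x + t * (Y y - Y x)

structure Good17 {V : Type} (G : SimpleGraph V) (X Y : V → ℝ) : Prop where
  inj : ∀ u v, X u = X v → Y u = Y v → u = v
  pl : ∀ u v x y s t, G.Adj u v → G.Adj x y → s(u, v) ≠ s(x, y) → Meet17 X Y u v x y s t →
    (s = 0 ∨ s = 1) ∧ (t = 0 ∨ t = 1)
  mx : ∀ u v, (∃ z, G.Adj u z) → (∃ z, G.Adj v z) → u ≠ v → ¬ G.Adj u v →
    ∃ x y s t, G.Adj x y ∧ Meet17 X Y u v x y s t ∧ 0 < s ∧ s < 1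

theorem Good17.swap {V : Type} {G : SimpleGraph V} {X Y : V → ℝ} (h : Good17 G X Y) :
    Good17 G Y X := by
  refine ⟨fun u v h1 h2 => h.inj u v h2 h1, ?_, ?_⟩
  · rintro u v x y s t h1 h2 h3 ⟨a, b, c, d, e, f⟩
    exact h.pl u v x y s t h1 h2 h3 ⟨a, b, c, d, f, e⟩
  · intro u v h1 h2 h3 h4
    obtain ⟨x, y, s, t, h5, ⟨a, b, c, d, e, f⟩, h6⟩ := h.mx u v h1 h2 h3 h4
    exact ⟨x, y, s, t, h5, ⟨a, b, c, d, f, e⟩, h6⟩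

theorem exit1_17 {V : Type} {G : SimpleGraph V} {X Y : V → ℝ} (h : Good17 G X Y)
    {v b : V} (hXv : X v = 0) (hYv : Y v = 0) (hXb : X b = 0) (hYb : Y b = 1)
    (hvb : G.Adj v b) (hno : ∀ z, G.Adj v z → 0 < X z → 0 < Y z → False)
    {x y : V} (hxy : G.Adj x y) {t : ℝ} (ht0 : 0 ≤ t) (ht1 : t ≤ 1)
    (hpx : 0 < X x + t * (X y - X x)) (hpy : 0 < Y x + t * (Y y - Y x))
    {t' : ℝ} (ht0' : 0 ≤ t') (ht1' : t' ≤ 1)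
    (hqx : X x + t' * (X y - X x) = 0) (hqy : 0 ≤ Y x + t' * (Y y - Y x))
    (hqs : Y x + t' * (Y y - Y x) < 1) : False := by
  have hne : s(v, b) ≠ s(x, y) := by
    intro he
    rw [Sym2.eq_iff] at he
    rcases he with ⟨rfl, rfl⟩ | ⟨rfl, rfl⟩ <;> simp [hXv, hXb] at hpx
  obtain ⟨h1, h2⟩ := h.pl v b x y (Y x + t' * (Y y - Y x)) t' hvb hxy hne
    ⟨hqy, hqs.le, ht0', ht1', by rw [hXv, hXb, hqx]; ring, by rw [hYv, hYb]; ring⟩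
  have hq0 : Y x + t' * (Y y - Y x) = 0 := by
    rcases h1 with h1 | h1
    · exact h1
    · linarith
  rcases h2 with rfl | rfl
  · have : v = x := h.inj _ _ (by linarith) (by linarith)
    subst this
    rw [hXv] at hpx
    rw [hYv] at hpy
    have e1 : 0 < t * X y := by linarith
    have e2 : 0 < t * Y y := by linarith
    exact hno y hxy (pos_of_mul_pos_right e1 ht0) (pos_of_mul_pos_right e2 ht0)
  · have : v = y := h.inj _ _ (by linarith) (by linarith)
    subst this
    rw [hXv] at hpx
    rw [hYv] at hpy
    have e1 : 0 < (1 - t) * X x := by linarith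
    have e2 : 0 < (1 - t) * Y x := by linarith
    exact hno x hxy.symm (pos_of_mul_pos_right e1 (by linarith))
      (pos_of_mul_pos_right e2 (by linarith))

theorem exit_17 {V : Type} {G : SimpleGraph V} {X Y : V → ℝ} (h : Good17 G X Y)
    {v a b : V} (hXv : X v = 0) (hYv : Y v = 0) (hXa : X a = 1) (hYa : Y a = 0)
    (hXb : X b = 0) (hYb : Y b = 1)
    (hva : G.Adj v a) (hvb : G.Adj v b) (hno : ∀ z, G.Adj v z → 0 < X z → 0 < Y z → False)
    {x y : V} (hxy : G.Adj x y) {t : ℝ} (ht0 : 0 ≤ t) (ht1 : t ≤ 1) {px py : ℝ}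
    (hX : px = X x + t * (X y - X x)) (hY : py = Y x + t * (Y y - Y x))
    (hpx : 0 < px) (hpy : 0 < py) (hs1 : X y + Y y ≤ px + py) (hs2 : px + py ≤ 1)
    (hs : px + py < 1 ∨ X y + Y y < px + py) : 0 < X y ∧ 0 < Y y := by
  by_contra hcon
  have hc : min (X y) (Y y) ≤ 0 := by
    by_contra h'
    exact hcon (lt_min_iff.1 (not_le.1 h'))
  let f : ℝ → ℝ := fun r => min (px + r * (X y - px)) (py + r * (Y y - py))
  have hf : ContinuousOn f (Set.Icc 0 1) := by
    apply Continuous.continuousOn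
    fun_prop
  have h0 : (0 : ℝ) ∈ Set.Icc (f 1) (f 0) := by
    constructor
    · simpa [f] using hc
    · simp [f, hpx.le, hpy.le]
  obtain ⟨r, ⟨hr0, hr1⟩, hfr⟩ := intermediate_value_Icc' (zero_le_one) hf h0
  have hr : 0 < r := by
    rcases hr0.eq_or_lt with h' | h'
    · subst h'
      have : 0 < f 0 := by simp [f, hpx, hpy]
      linarith
    · exact h'
  have hsum : px + r * (X y - px) + (py + r * (Y y - py)) < 1 := by
    rcases hs with h' | h' <;> nlinarith
  have ht0' : 0 ≤ t + r * (1 - t) := by nlinarith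
  have ht1' : t + r * (1 - t) ≤ 1 := by nlinarith
  have eX : X x + (t + r * (1 - t)) * (X y - X x) = px + r * (X y - px) := by rw [hX]; ring
  have eY : Y x + (t + r * (1 - t)) * (Y y - Y x) = py + r * (Y y - py) := by rw [hY]; ring
  have g1 : 0 ≤ px + r * (X y - px) := by rw [← hfr]; exact min_le_left _ _
  have g2 : 0 ≤ py + r * (Y y - py) := by rw [← hfr]; exact min_le_right _ _
  rcases min_choice (px + r * (X y - px)) (py + r * (Y y - py)) with h' | h'
  · have h3 : px + r * (X y - px) = 0 := by rw [← h']; exact hfr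
    exact exit1_17 h hXv hYv hXb hYb hvb hno hxy ht0 ht1 (hX ▸ hpx) (hY ▸ hpy) ht0' ht1'
      (by rw [eX, h3]) (by rw [eY]; exact g2) (by rw [eY]; linarith)
  · have h3 : py + r * (Y y - py) = 0 := by rw [← h']; exact hfr
    exact exit1_17 h.swap hYv hXv hYa hXa hva (fun z a b c => hno z a c b) hxy ht0 ht1
      (hY ▸ hpy) (hX ▸ hpx) ht0' ht1'
      (by rw [eY, h3]) (by rw [eX]; exact g1) (by rw [eX]; linarith)

theorem Meet17.symm {V : Type} {X Y : V → ℝ} {u v x y : V} {s t : ℝ}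
    (h : Meet17 X Y u v x y s t) : Meet17 X Y u v y x s (1 - t) := by
  obtain ⟨a, b, c, d, e, f⟩ := h
  exact ⟨a, b, by linarith, by linarith, by rw [e]; ring, by rw [f]; ring⟩

theorem empty_17 {V : Type} [Fintype V] {G : SimpleGraph V} {X Y : V → ℝ} (h : Good17 G X Y)
    {v a b : V} (hXv : X v = 0) (hYv : Y v = 0) (hXa : X a = 1) (hYa : Y a = 0)
    (hXb : X b = 0) (hYb : Y b = 1)
    (hva : G.Adj v a) (hvb : G.Adj v b) (hno : ∀ z, G.Adj v z → 0 < X z → 0 < Y z → False)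
    (w : V) (hw : ∃ z, G.Adj w z) (hwx : 0 < X w) (hwy : 0 < Y w) (hw1 : X w + Y w ≤ 1) :
    False := by
  classical
  let W : Finset V := Finset.univ.filter
    fun w => (∃ z, G.Adj w z) ∧ 0 < X w ∧ 0 < Y w ∧ X w + Y w ≤ 1
  obtain ⟨m, hm, hmin⟩ := W.exists_min_image (fun w => X w + Y w)
    ⟨w, by simp only [W, Finset.mem_filter, Finset.mem_univ, true_and]; exact ⟨hw, hwx, hwy, hw1⟩⟩
  simp only [W, Finset.mem_filter, Finset.mem_univ, true_and] at hm hmin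
  obtain ⟨hmz, hmx, hmy, hm1⟩ := hm
  have hne : v ≠ m := by rintro rfl; linarith
  obtain ⟨x, y, s, t, hxy, hM, hs0, hs1⟩ := h.mx v m ⟨a, hva⟩ hmz hne (fun h' => hno m h' hmx hmy)
  have key : ∀ x y t, G.Adj x y → Meet17 X Y v m x y s t → X y + Y y ≤ X x + Y x → False := by
    rintro x y t hxy ⟨-, -, ht0, ht1, e, f⟩ hle
    rw [hXv] at e
    rw [hYv] at f
    have e' : s * X m = X x + t * (X y - X x) := by linarith
    have f' : s * Y m = Y x + t * (Y y - Y x) := by linarith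
    have q1 : s * X m < X m := by nlinarith
    have q2 : s * Y m < Y m := by nlinarith
    have q3 : X y + Y y ≤ s * X m + s * Y m := by rw [e', f']; nlinarith
    obtain ⟨k1, k2⟩ := exit_17 h hXv hYv hXa hYa hXb hYb hva hvb hno hxy ht0 ht1 e' f'
      (by positivity) (by positivity) q3 (by linarith) (Or.inl (by linarith))
    have := hmin y ⟨⟨x, hxy.symm⟩, k1, k2, by linarith⟩
    linarith
  rcases le_total (X y + Y y) (X x + Y x) with hle | hle
  · exact key x y t hxy hM hle
  · exact key y x (1 - t) hxy.symm hM.symm hle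

theorem core_17 {V : Type} [Fintype V] {G : SimpleGraph V} {X Y : V → ℝ} (h : Good17 G X Y)
    {v a b : V} (hXv : X v = 0) (hYv : Y v = 0) (hXa : X a = 1) (hYa : Y a = 0)
    (hXb : X b = 0) (hYb : Y b = 1)
    (hva : G.Adj v a) (hvb : G.Adj v b) (hno : ∀ z, G.Adj v z → 0 < X z → 0 < Y z → False) :
    G.Adj a b := by
  by_contra hab
  have hemp := empty_17 h hXv hYv hXa hYa hXb hYb hva hvb hno
  have hne : a ≠ b := by rintro rfl; linarith
  obtain ⟨x, y, s, t, hxy, hM, hs0, hs1⟩ := h.mx a b ⟨v, hva.symm⟩ ⟨v, hvb.symm⟩ hne hab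
  -- both endpoints on the line, x left, y right
  have key2 : ∀ x y, G.Adj x y → X x + Y x = 1 → X y + Y y = 1 → X x ≤ 0 → 1 ≤ X y → False := by
    intro x y hxy h1 h2 h3 h4
    have hd : 0 < X y - X x := by linarith
    have n1 : s(v, b) ≠ s(x, y) := by
      intro he
      rw [Sym2.eq_iff] at he
      rcases he with ⟨rfl, rfl⟩ | ⟨rfl, rfl⟩ <;> linarith
    have n2 : s(v, a) ≠ s(x, y) := by
      intro he
      rw [Sym2.eq_iff] at he
      rcases he with ⟨rfl, rfl⟩ | ⟨rfl, rfl⟩ <;> linarith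
    have y1 : Y x = 1 - X x := by linarith
    have y2 : Y y = 1 - X y := by linarith
    have m1 := (h.pl v b x y 1 ((0 - X x) / (X y - X x)) hvb hxy n1
      ⟨by norm_num, le_rfl, by apply div_nonneg <;> linarith, by rw [div_le_one hd]; linarith,
        by rw [hXv, hXb]; field_simp; ring, by rw [hYv, hYb, y1, y2]; field_simp; ring⟩).2
    have m2 := (h.pl v a x y 1 ((1 - X x) / (X y - X x)) hva hxy n2
      ⟨by norm_num, le_rfl, by apply div_nonneg <;> linarith, by rw [div_le_one hd]; linarith,
        by rw [hXv, hXa]; field_simp; ring, by rw [hYv, hYa, y1, y2]; field_simp; ring⟩).2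
    rw [div_eq_zero_iff, div_eq_one_iff_eq hd.ne'] at m1 m2
    have x0 : X x = 0 := by rcases m1 with (m1 | m1) | m1 <;> linarith
    have x1 : X y = 1 := by rcases m2 with (m2 | m2) | m2 <;> linarith
    have e1 : b = x := h.inj _ _ (by linarith) (by linarith)
    have e2 : a = y := h.inj _ _ (by linarith) (by linarith)
    subst e1 e2
    exact hab hxy.symm
  have key : ∀ x y t, G.Adj x y → Meet17 X Y a b x y s t → X y + Y y ≤ X x + Y x → False := by
    rintro x y t hxy ⟨-, -, ht0, ht1, e, f⟩ hle
    rw [hXa, hXb] at e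
    rw [hYa, hYb] at f
    have e' : 1 - s = X x + t * (X y - X x) := by linarith
    have f' : s = Y x + t * (Y y - Y x) := by linarith
    have q3 : X y + Y y ≤ (1 - s) + s := by nlinarith
    rcases q3.eq_or_lt with q | q
    · rcases ht1.eq_or_lt with ht | ht
      · subst ht
        exact hemp y ⟨x, hxy.symm⟩ (by linarith) (by linarith) (by linarith)
      · have hx1 : X x + Y x = 1 := by
          have : (1 - t) * (X x + Y x - 1) = 0 := by
            linear_combination - t * q - (e' + f')
          rcases mul_eq_zero.1 this with h' | h' <;> linarith
        have hy1 : X y + Y y = 1 := by linarith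
        have ox : ∀ z, (∃ u, G.Adj z u) → X z + Y z = 1 → X z ≤ 0 ∨ 1 ≤ X z := by
          intro z hz hz1
          by_contra! hcon
          exact hemp z hz hcon.1 (by linarith) hz1.le
        rcases ox x ⟨y, hxy⟩ hx1 with a1 | a1 <;> rcases ox y ⟨x, hxy.symm⟩ hy1 with a2 | a2
        · nlinarith
        · exact key2 x y hxy hx1 hy1 a1 a2
        · exact key2 y x hxy.symm hy1 hx1 a2 a1
        · nlinarith
    · obtain ⟨k1, k2⟩ := exit_17 h hXv hYv hXa hYa hXb hYb hva hvb hno hxy ht0 ht1 e' f'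
        (by linarith) hs0 q.le (by linarith) (Or.inr q)
      exact hemp y ⟨x, hxy.symm⟩ k1 k2 (by linarith)
  rcases le_total (X y + Y y) (X x + Y x) with hle | hle
  · exact key x y t hxy hM hle
  · exact key y x (1 - t) hxy.symm hM.symm hle

/-- affine change of coordinates -/
theorem Good17.affine {V : Type} {G : SimpleGraph V} {X Y X' Y' : V → ℝ} (h : Good17 G X Y)
    {c d a1 a2 b1 b2 : ℝ} (hD : a1 * b2 - a2 * b1 ≠ 0)
    (hX : ∀ z, X z = c + X' z * a1 + Y' z * b1) (hY : ∀ z, Y z = d + X' z * a2 + Y' z * b2) :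
    Good17 G X' Y' := by
  have hM : ∀ u v x y s t, Meet17 X Y u v x y s t ↔ Meet17 X' Y' u v x y s t := by
    intro u v x y s t
    unfold Meet17
    simp only [hX, hY]
    constructor
    · rintro ⟨p, q, r, w, e, f⟩
      refine ⟨p, q, r, w, ?_, ?_⟩
      · apply mul_left_cancel₀ hD
        linear_combination b2 * e - b1 * f
      · apply mul_left_cancel₀ hD
        linear_combination a1 * f - a2 * e
    · rintro ⟨p, q, r, w, e, f⟩
      refine ⟨p, q, r, w, ?_, ?_⟩
      · linear_combination a1 * e + b1 * f
      · linear_combination a2 * e + b2 * f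
  refine ⟨fun u v h1 h2 => h.inj u v (by simp only [hX, h1, h2]) (by simp only [hY, h1, h2]), ?_, ?_⟩
  · intro u v x y s t h1 h2 h3 h4
    exact h.pl u v x y s t h1 h2 h3 ((hM ..).2 h4)
  · intro u v h1 h2 h3 h4
    obtain ⟨x, y, s, t, h5, h6, h7⟩ := h.mx u v h1 h2 h3 h4
    exact ⟨x, y, s, t, h5, (hM ..).1 h6, h7⟩

def Left17 {V : Type} (X Y : V → ℝ) (w v : V) : Prop :=
  X w < X v ∨ (X w = X v ∧ Y w < Y v)

def Wedge17 {V : Type} (X Y : V → ℝ) (v a b w : V) : Prop :=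
  ∃ β γ : ℝ, 0 < β ∧ 0 < γ ∧ X w - X v = β * (X a - X v) + γ * (X b - X v) ∧
    Y w - Y v = β * (Y a - Y v) + γ * (Y b - Y v)

theorem indep_17 {V : Type} {G : SimpleGraph V} {X Y : V → ℝ} (h : Good17 G X Y)
    {v a b : V} (hva : G.Adj v a) (hvb : G.Adj v b) (ha : Left17 X Y a v) (hb : Left17 X Y b v)
    (hab : a ≠ b) : (X a - X v) * (Y b - Y v) - (Y a - Y v) * (X b - X v) ≠ 0 := by
  intro hD
  have key : ∀ a b, G.Adj v a → G.Adj v b → a ≠ b → ∀ r : ℝ, 0 < r → r ≤ 1 →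
      X b - X v = r * (X a - X v) → Y b - Y v = r * (Y a - Y v) → False := by
    intro a b hva hvb hab r h0 h1 e f
    have hne : s(v, a) ≠ s(v, b) := by
      intro he
      rw [Sym2.eq_iff] at he
      rcases he with ⟨_, h'⟩ | ⟨h', h''⟩
      · exact hab h'
      · exact hvb.ne h'
    rcases (h.pl v a v b r 1 hva hvb hne ⟨h0.le, h1, by norm_num, le_rfl, by linarith,
      by linarith⟩).1 with h' | h'
    · linarith
    · subst h'
      exact hab (h.inj _ _ (by linarith) (by linarith))
  have main : ∃ r : ℝ, 0 < r ∧ X b - X v = r * (X a - X v) ∧ Y b - Y v = r * (Y a - Y v) := by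
    rcases ha with ha | ⟨ha, ha'⟩
    · have n : X a - X v ≠ 0 := by linarith
      rcases hb with hb | ⟨hb, hb'⟩
      · refine ⟨(X b - X v) / (X a - X v), div_pos_of_neg_of_neg (by linarith) (by linarith), ?_, ?_⟩
        · field_simp
        · field_simp; linarith
      · exfalso
        rw [hb] at hD
        have : (X a - X v) * (Y b - Y v) = 0 := by linarith
        rcases mul_eq_zero.1 this with h' | h' <;> linarith
    · have n : Y a - Y v ≠ 0 := by linarith
      have e : X b - X v = 0 := by
        rw [ha] at hD
        have : (Y a - Y v) * (X b - X v) = 0 := by linarith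
        exact (mul_eq_zero.1 this).resolve_left n
      rcases hb with hb | ⟨hb, hb'⟩
      · linarith
      · refine ⟨(Y b - Y v) / (Y a - Y v), div_pos_of_neg_of_neg (by linarith) (by linarith), ?_, ?_⟩
        · rw [e, ha]; ring
        · field_simp
  obtain ⟨r, hr, e, f⟩ := main
  rcases le_total r 1 with h1 | h1
  · exact key a b hva hvb hab r hr h1 e f
  · refine key b a hvb hva hab.symm r⁻¹ (by positivity) (inv_le_one_of_one_le₀ h1) ?_ ?_
    · rw [e]; field_simp
    · rw [f]; field_simp

theorem link_17 {V : Type} [Fintype V] {G : SimpleGraph V} {X Y : V → ℝ} (h : Good17 G X Y)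
    (v : V) (φ : V → ZMod 2)
    (hφ : ∀ a b, G.Adj v a → G.Adj v b → Left17 X Y a v → Left17 X Y b v → G.Adj a b → φ a = φ b)
    (n : ℕ) : ∀ a b, G.Adj v a → G.Adj v b → Left17 X Y a v → Left17 X Y b v →
      {w | G.Adj v w ∧ Wedge17 X Y v a b w}.ncard ≤ n → φ a = φ b := by
  induction n using Nat.strong_induction_on with
  | _ n ih =>
  intro a b hva hvb ha hb hn
  by_cases hab : a = b
  · rw [hab]
  have hD := indep_17 h hva hvb ha hb hab
  by_cases hw : ∃ w, G.Adj v w ∧ Wedge17 X Y v a b w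
  · obtain ⟨w, hvw, hW⟩ := hw
    have hWc := hW
    obtain ⟨β, γ, hβ, hγ, e, f⟩ := hW
    have hwl : Left17 X Y w v := by
      rcases ha with ha | ⟨ha, ha'⟩ <;> rcases hb with hb | ⟨hb, hb'⟩
      · left; nlinarith
      · left; rw [hb] at e; nlinarith
      · left; rw [ha] at e; nlinarith
      · right; rw [ha, hb] at e; exact ⟨by linarith, by nlinarith⟩
    have s1 : {z | G.Adj v z ∧ Wedge17 X Y v a w z}.ncard <
        {z | G.Adj v z ∧ Wedge17 X Y v a b z}.ncard := by
      apply Set.ncard_lt_ncard _ (Set.toFinite _)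
      refine (Set.ssubset_iff_of_subset ?_).2 ⟨w, ⟨hvw, hWc⟩, ?_⟩
      · rintro z ⟨hz, β', γ', hβ', hγ', e', f'⟩
        exact ⟨hz, β' + γ' * β, γ' * γ, by positivity, by positivity,
          by rw [e', e]; ring, by rw [f', f]; ring⟩
      · rintro ⟨-, β', γ', hβ', hγ', e', f'⟩
        have : β' * γ * ((X a - X v) * (Y b - Y v) - (Y a - Y v) * (X b - X v)) = 0 := by
          rw [e, f] at *
          linear_combination (-(β * (Y a - Y v) + γ * (Y b - Y v))) * e' +
            (β * (X a - X v) + γ * (X b - X v)) * f'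
        exact (mul_ne_zero (by positivity) hD) this
    have s2 : {z | G.Adj v z ∧ Wedge17 X Y v w b z}.ncard <
        {z | G.Adj v z ∧ Wedge17 X Y v a b z}.ncard := by
      apply Set.ncard_lt_ncard _ (Set.toFinite _)
      refine (Set.ssubset_iff_of_subset ?_).2 ⟨w, ⟨hvw, hWc⟩, ?_⟩
      · rintro z ⟨hz, β', γ', hβ', hγ', e', f'⟩
        exact ⟨hz, β' * β, β' * γ + γ', by positivity, by positivity,
          by rw [e', e]; ring, by rw [f', f]; ring⟩
      · rintro ⟨-, β', γ', hβ', hγ', e', f'⟩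
        have : γ' * β * ((X a - X v) * (Y b - Y v) - (Y a - Y v) * (X b - X v)) = 0 := by
          rw [e, f] at *
          linear_combination ((β * (Y a - Y v) + γ * (Y b - Y v))) * e' -
            (β * (X a - X v) + γ * (X b - X v)) * f'
        exact (mul_ne_zero (by positivity) hD) this
    exact (ih _ (s1.trans_le hn) a w hva hvw ha hwl le_rfl).trans
      (ih _ (s2.trans_le hn) w b hvw hvb hwl hb le_rfl)
  · refine hφ a b hva hvb ha hb ?_
    set D := (X a - X v) * (Y b - Y v) - (Y a - Y v) * (X b - X v) with hDdef
    let X' : V → ℝ := fun z => ((X z - X v) * (Y b - Y v) - (Y z - Y v) * (X b - X v)) / D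
    let Y' : V → ℝ := fun z => ((X a - X v) * (Y z - Y v) - (Y a - Y v) * (X z - X v)) / D
    have eX : ∀ z, X z = X v + X' z * (X a - X v) + Y' z * (X b - X v) := by
      intro z
      simp only [X', Y']
      field_simp
      rw [hDdef]; ring
    have eY : ∀ z, Y z = Y v + X' z * (Y a - Y v) + Y' z * (Y b - Y v) := by
      intro z
      simp only [X', Y']
      field_simp
      rw [hDdef]; ring
    have hG : Good17 G X' Y' := h.affine hD eX eY
    refine core_17 hG (v := v) (by simp [X']) (by simp [Y']) (div_self hD) ?_ ?_ (div_self hD)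
      hva hvb ?_
    · simp only [Y']; rw [div_eq_zero_iff]; left; ring
    · simp only [X']; rw [div_eq_zero_iff]; left; ring
    · intro z hz h1 h2
      exact hw ⟨z, hz, X' z, Y' z, h1, h2, by linarith [eX z], by linarith [eY z]⟩

theorem potential_17 {V : Type} [Fintype V] [DecidableEq V] {G : SimpleGraph V} {X Y : V → ℝ}
    (h : Good17 G X Y)
    (g : Sym2 V → ZMod 2)
    (hg : ∀ a b c, G.Adj a b → G.Adj b c → G.Adj a c → g s(a, b) + g s(b, c) + g s(a, c) = 0) :
    ∃ φ : V → ZMod 2, ∀ a b, G.Adj a b → g s(a, b) = φ a + φ b := by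
  have z2 : ∀ x : ZMod 2, x + x = 0 := by decide
  let f : V → ℝ ×ₗ ℝ := fun z => toLex (X z, Y z)
  have hf : ∀ a b, f a < f b ↔ Left17 X Y a b := by
    intro a b
    simp [f, Prod.Lex.toLex_lt_toLex, Left17]
  have hinj : Function.Injective f := by
    intro a b hab
    have := toLex.injective hab
    rw [Prod.mk.injEq] at this
    exact h.inj a b this.1 this.2
  have main : ∀ s : Finset V, (∀ a ∈ s, ∀ b, f b < f a → b ∈ s) →
      ∃ φ : V → ZMod 2, ∀ a ∈ s, ∀ b ∈ s, G.Adj a b → g s(a, b) = φ a + φ b := by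
    intro s
    induction s using Finset.induction_on_max_value f with
    | empty => intro _; exact ⟨0, by simp⟩
    | insert v s hv hmax ih =>
      intro hdown
      have hlt : ∀ x ∈ s, f x < f v := fun x hx =>
        lt_of_le_of_ne (hmax x hx) (fun e => hv (hinj e ▸ hx))
      have hmem : ∀ x, f x < f v → x ∈ s := by
        intro x hx
        rcases Finset.mem_insert.1 (hdown v (Finset.mem_insert_self _ _) x hx) with rfl | h'
        · exact absurd hx (lt_irrefl _)
        · exact h'
      obtain ⟨φ, hφ⟩ := ih (fun a ha b hb => hmem b (hb.trans (hlt a ha)))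
      have hlink : ∀ a ∈ s, ∀ b ∈ s, G.Adj v a → G.Adj v b →
          φ a + g s(v, a) = φ b + g s(v, b) := by
        intro a ha b hb hva hvb
        refine link_17 h v (fun a => φ a + g s(v, a)) ?_ _ a b hva hvb ((hf _ _).1 (hlt a ha))
          ((hf _ _).1 (hlt b hb)) le_rfl
        intro a b hva hvb ha hb hab
        have t1 := hg v a b hva hab hvb
        have t2 := hφ a (hmem a ((hf _ _).2 ha)) b (hmem b ((hf _ _).2 hb)) hab
        rw [t2] at t1
        show φ a + g s(v, a) = φ b + g s(v, b)
        linear_combination t1 - z2 (φ b) - z2 (g s(v, b))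
      have hc : ∃ c : ZMod 2, ∀ a ∈ s, G.Adj v a → g s(v, a) = c + φ a := by
        by_cases he : ∃ a ∈ s, G.Adj v a
        · obtain ⟨a, ha, hva⟩ := he
          refine ⟨φ a + g s(v, a), fun b hb hvb => ?_⟩
          rw [hlink a ha b hb hva hvb]
          linear_combination - z2 (φ b)
        · exact ⟨0, fun a ha hva => absurd ⟨a, ha, hva⟩ he⟩
      obtain ⟨c, hc⟩ := hc
      refine ⟨Function.update φ v c, ?_⟩
      intro a ha b hb hab
      rcases Finset.mem_insert.1 ha with rfl | ha' <;> rcases Finset.mem_insert.1 hb with rfl | hb'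
      · exact absurd rfl hab.ne
      · rw [Function.update_self, Function.update_of_ne hab.ne']
        exact hc b hb' hab
      · rw [Function.update_self, Function.update_of_ne hab.ne, Sym2.eq_swap, add_comm]
        exact hc a ha' hab.symm
      · have n1 : a ≠ v := by rintro rfl; exact hv ha'
        have n2 : b ≠ v := by rintro rfl; exact hv hb'
        rw [Function.update_of_ne n1, Function.update_of_ne n2]
        exact hφ a ha' b hb' hab
  obtain ⟨φ, hφ⟩ := main Finset.univ (by simp)
  exact ⟨φ, fun a b hab => hφ a (Finset.mem_univ _) b (Finset.mem_univ _) hab⟩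

theorem seg_17 (a b p : ℝ × ℝ) : p ∈ segment ℝ a b ↔
    ∃ s : ℝ, 0 ≤ s ∧ s ≤ 1 ∧ p = (a.1 + s * (b.1 - a.1), a.2 + s * (b.2 - a.2)) := by
  rw [segment_eq_image']
  constructor
  · rintro ⟨s, ⟨h0, h1⟩, rfl⟩
    exact ⟨s, h0, h1, by ext <;> simp⟩
  · rintro ⟨s, h0, h1, rfl⟩
    exact ⟨s, ⟨h0, h1⟩, by ext <;> simp⟩

theorem end_17 {a b : ℝ × ℝ} (hab : a ≠ b) {s : ℝ} :
    ((a.1 + s * (b.1 - a.1), a.2 + s * (b.2 - a.2)) = a ∨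
      (a.1 + s * (b.1 - a.1), a.2 + s * (b.2 - a.2)) = b) ↔ (s = 0 ∨ s = 1) := by
  constructor
  · rintro (h | h)
    · left
      by_contra hs
      apply hab
      rw [Prod.ext_iff] at h
      obtain ⟨h1, h2⟩ := h
      simp only at h1 h2
      have h1' : s * (b.1 - a.1) = 0 := by linarith
      have h2' : s * (b.2 - a.2) = 0 := by linarith
      have := (mul_eq_zero.1 h1').resolve_left hs
      have := (mul_eq_zero.1 h2').resolve_left hs
      ext <;> linarith
    · right
      by_contra hs
      apply hab
      have hs' : s - 1 ≠ 0 := sub_ne_zero.2 hs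
      rw [Prod.ext_iff] at h
      obtain ⟨h1, h2⟩ := h
      simp only at h1 h2
      have h1' : (s - 1) * (b.1 - a.1) = 0 := by linarith
      have h2' : (s - 1) * (b.2 - a.2) = 0 := by linarith
      have := (mul_eq_zero.1 h1').resolve_left hs'
      have := (mul_eq_zero.1 h2').resolve_left hs'
      ext <;> linarith
  · rintro (rfl | rfl)
    · left; ext <;> simp
    · right; ext <;> simp

theorem good_17 {V : Type} [Fintype V] {G : SimpleGraph V} (hG : IsMaximalPlanar G) :
    ∃ X Y : V → ℝ, Good17 G X Y := by
  obtain ⟨⟨pos, hinj, hpl⟩, hmax⟩ := hG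
  have inj : ∀ u v, (pos u).1 = (pos v).1 → (pos u).2 = (pos v).2 → u = v :=
    fun u v h1 h2 => hinj (Prod.ext h1 h2)
  have pl : ∀ u v x y s t, G.Adj u v → G.Adj x y → s(u, v) ≠ s(x, y) →
      Meet17 (fun z => (pos z).1) (fun z => (pos z).2) u v x y s t →
      (s = 0 ∨ s = 1) ∧ (t = 0 ∨ t = 1) := by
    rintro u v x y s t huv hxy hne ⟨s0, s1, t0, t1, e, f⟩
    simp only at e f
    have := hpl u v x y huv hxy hne _ ((seg_17 _ _ _).2 ⟨s, s0, s1, rfl⟩)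
      ((seg_17 _ _ _).2 ⟨t, t0, t1, by rw [e, f]⟩)
    refine ⟨(end_17 (fun h => huv.ne (hinj h))).1 this.1, ?_⟩
    rw [e, f] at this
    exact (end_17 (fun h => hxy.ne (hinj h))).1 this.2
  refine ⟨fun z => (pos z).1, fun z => (pos z).2, inj, pl, ?_⟩
  intro u v hu hv huv hnadj
  -- a crossing exists
  have hcross : ∃ x y p, G.Adj x y ∧ p ∈ segment ℝ (pos u) (pos v) ∧ p ∈ segment ℝ (pos x) (pos y) ∧
      ¬ ((p = pos u ∨ p = pos v) ∧ (p = pos x ∨ p = pos y)) := by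
    by_contra! hcon
    apply hmax u v huv hnadj
    have hA : ∀ a b, (G ⊔ SimpleGraph.fromEdgeSet {s(u, v)}).Adj a b →
        G.Adj a b ∨ (a = u ∧ b = v) ∨ (a = v ∧ b = u) := by
      intro a b hab
      rw [SimpleGraph.sup_adj, SimpleGraph.fromEdgeSet_adj] at hab
      rcases hab with h | ⟨h, -⟩
      · exact Or.inl h
      · rw [Set.mem_singleton_iff, Sym2.eq_iff] at h
        exact Or.inr h
    refine ⟨pos, hinj, ?_⟩
    intro a b x y hab hxy hne p hp hq
    rcases hA a b hab with h1 | ⟨rfl, rfl⟩ | ⟨rfl, rfl⟩ <;>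
      rcases hA x y hxy with h2 | ⟨rfl, rfl⟩ | ⟨rfl, rfl⟩
    · exact hpl a b x y h1 h2 hne p hp hq
    · exact (hcon a b p h1 hq hp).symm
    · rw [segment_symm] at hq
      have := hcon a b p h1 hq hp
      tauto
    · exact hcon x y p h2 hp hq
    · exact absurd rfl hne
    · exact absurd Sym2.eq_swap hne
    · rw [segment_symm] at hp
      have := hcon x y p h2 hp hq
      tauto
    · exact absurd Sym2.eq_swap hne
    · exact absurd rfl hne
  obtain ⟨x, y, p, hxy, hp, hq, hbad⟩ := hcross
  obtain ⟨s, s0, s1, hs⟩ := (seg_17 _ _ _).1 hp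
  obtain ⟨t, t0, t1, ht⟩ := (seg_17 _ _ _).1 hq
  have hvert : ∀ w, (∃ z, G.Adj w z) → p = pos w → p = pos x ∨ p = pos y := by
    rintro w ⟨z, hz⟩ hw
    by_cases he : s(w, z) = s(x, y)
    · rw [Sym2.eq_iff] at he
      rcases he with ⟨rfl, rfl⟩ | ⟨rfl, rfl⟩
      · exact Or.inl hw
      · exact Or.inr hw
    · exact (hpl w z x y hz hxy he p (hw ▸ left_mem_segment ℝ _ _) hq).2
  have hns : ¬ (s = 0 ∨ s = 1) := by
    intro h'
    have h2 := (end_17 (fun h => huv (hinj h))).2 h'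
    rw [← hs] at h2
    refine hbad ⟨h2, ?_⟩
    rcases h2 with h2 | h2
    · exact hvert u hu h2
    · exact hvert v hv h2
  push Not at hns
  have hst := hs.symm.trans ht
  rw [Prod.mk.injEq] at hst
  exact ⟨x, y, s, t, hxy, ⟨s0, s1, t0, t1, hst.1, hst.2⟩, lt_of_le_of_ne s0 hns.1.symm,
    lt_of_le_of_ne s1 hns.2⟩

theorem walk_17 {V : Type} {G : SimpleGraph V} (col : Sym2 V → Fin 3) (i : Fin 3)
    (φ : V → ZMod 2)
    (hφ : ∀ a b, G.Adj a b → (if col s(a, b) = i then (0 : ZMod 2) else 1) = φ a + φ b)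
    {u v : V} (p : G.Walk u v) :
    ((p.edges.filter fun e => col e = i).length : ZMod 2) = p.length + φ u + φ v := by
  have z2 : ∀ x : ZMod 2, x + x = 0 := by decide
  induction p with
  | nil => simp [z2]
  | @cons a b c hab q ih =>
    have := hφ a b hab
    rw [SimpleGraph.Walk.edges_cons, SimpleGraph.Walk.length_cons, List.filter_cons]
    by_cases hc : col s(a, b) = i
    · simp only [hc, decide_true, if_true, List.length_cons] at *
      push_cast
      rw [ih]
      linear_combination this + z2 (φ b)
    · simp only [hc, decide_false, if_false] at *
      push_cast
      rw [ih]
      linear_combination this + z2 (φ b) - z2 1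

/-- In an RGB-tiling of a planar triangulation (an edge 3-coloring in which every
triangle receives three distinct colors), along any cycle `C` the numbers of red,
green and blue edges all have the same parity as the length of `C`. -/
theorem stmt_17 {V : Type} [Fintype V] [DecidableEq V] (G : SimpleGraph V)
    (hG : IsMaximalPlanar G)
    (col : Sym2 V → Fin 3)
    (hrainbow : ∀ a b c : V, G.Adj a b → G.Adj b c → G.Adj a c →
      col s(a, b) ≠ col s(b, c) ∧ col s(b, c) ≠ col s(a, c) ∧ col s(a, b) ≠ col s(a, c))
    {v : V} (p : G.Walk v v) (hp : p.IsCycle) :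
    ∀ i : Fin 3, (p.edges.filter fun e => col e = i).length % 2 = p.length % 2 := by
  intro i
  obtain ⟨X, Y, h⟩ := good_17 hG
  obtain ⟨φ, hφ⟩ := potential_17 h (fun e => if col e = i then (0 : ZMod 2) else 1) (by
    intro a b c h1 h2 h3
    have := hrainbow a b c h1 h2 h3
    revert this
    show _ → (if col s(a, b) = i then (0 : ZMod 2) else 1) + (if col s(b, c) = i then 0 else 1) +
      (if col s(a, c) = i then 0 else 1) = 0
    generalize col s(a, b) = x
    generalize col s(b, c) = y
    generalize col s(a, c) = z
    revert x y z i
    decide)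
  have z2 : ∀ x : ZMod 2, x + x = 0 := by decide
  have := walk_17 col i φ hφ p
  rw [add_assoc, z2, add_zero] at this
  exact (ZMod.natCast_eq_natCast_iff' _ _ 2).1 this
end
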